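/- arXiv:math/0310369 — 4 statements merged into one kernel-verified Lean document; each statement's English description precedes it below -/
import Mathlib

section
/- Let n ≥ 1, let C be a commutative integral domain and let Q be a prime ideal of C. Let c : ℕ^n × ℕ^n × ℕ → C be a family of elements of C (the coefficient family of an element g of the homogenized ring of formal differential operators D̂_n(C[h^{-1}])⟨z⟩) such that the set {(β,k) ∈ ℕ^n × ℕ : there exists α ∈ ℕ^n with c(α,β,k) ≠ 0} is finite. Then there exists H ∈ C \ Q such that for every prime ideal P of C with Q ⊆ P and H ∉ P, one has New_P(c) = New_Q(c), i.e. convexHull(Supp_P(c)) + W^⋆ = convexHull(Supp_Q(c)) + W^⋆ as subsets of ℝ^{2n+1}. -/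
open Pointwise

/-- Embedding of `ℕ^n × ℕ^n × ℕ` into `ℝ^n × ℝ^n × ℝ`. -/
def toR (n : ℕ) (γ : (Fin n → ℕ) × (Fin n → ℕ) × ℕ) :
    (Fin n → ℝ) × (Fin n → ℝ) × ℝ :=
  (fun i => (γ.1 i : ℝ), fun i => (γ.2.1 i : ℝ), (γ.2.2 : ℝ))

/-- The cone `W^⋆ ⊆ ℝ^{2n+1}`, generated by the vectors `(e_i, 0)` and `(e'_i, 0)`,
where `e_i` is the `i`-th standard basis vector of `ℝ^{2n}` and `e'_i` has `-1` at
positions `i` and `n+i` and `0` elsewhere. -/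
def Wstar (n : ℕ) : Set ((Fin n → ℝ) × (Fin n → ℝ) × ℝ) :=
  { p | ∃ a b : Fin n → ℝ, (∀ i, 0 ≤ a i) ∧ (∀ i, 0 ≤ b i) ∧
      p = ∑ i : Fin n,
        (a i • ((Pi.single i 1 : Fin n → ℝ), (0 : Fin n → ℝ), (0 : ℝ)) +
         b i • (-(Pi.single i 1 : Fin n → ℝ), -(Pi.single i 1 : Fin n → ℝ), (0 : ℝ))) }

/-- The support of a coefficient family `c` modulo an ideal `P`. -/
def suppMod {C : Type*} [CommRing C] {n : ℕ}
    (c : (Fin n → ℕ) × (Fin n → ℕ) × ℕ → C) (P : Ideal C) :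
    Set ((Fin n → ℕ) × (Fin n → ℕ) × ℕ) :=
  { γ | c γ ∉ P }

theorem Wstar_add_mem {n : ℕ} {p q : (Fin n → ℝ) × (Fin n → ℝ) × ℝ}
    (hp : p ∈ Wstar n) (hq : q ∈ Wstar n) : p + q ∈ Wstar n := by
  obtain ⟨a, b, ha, hb, rfl⟩ := hp
  obtain ⟨a', b', ha', hb', rfl⟩ := hq
  refine ⟨a + a', b + b', fun i => add_nonneg (ha i) (ha' i),
    fun i => add_nonneg (hb i) (hb' i), ?_⟩
  rw [← Finset.sum_add_distrib]
  refine Finset.sum_congr rfl fun i _ => ?_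
  rw [Pi.add_apply, Pi.add_apply, add_smul, add_smul]
  abel

theorem Wstar_smul_mem {n : ℕ} {p : (Fin n → ℝ) × (Fin n → ℝ) × ℝ} {t : ℝ}
    (ht : 0 ≤ t) (hp : p ∈ Wstar n) : t • p ∈ Wstar n := by
  obtain ⟨a, b, ha, hb, rfl⟩ := hp
  refine ⟨t • a, t • b, fun i => mul_nonneg ht (ha i), fun i => mul_nonneg ht (hb i), ?_⟩
  rw [Finset.smul_sum]
  refine Finset.sum_congr rfl fun i _ => ?_
  rw [smul_add, smul_smul, smul_smul]
  rfl

theorem convex_Wstar (n : ℕ) : Convex ℝ (Wstar n) :=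
  fun _ hp _ hq _ _ hs ht _ => Wstar_add_mem (Wstar_smul_mem hs hp) (Wstar_smul_mem ht hq)

theorem mk_zero_mem_Wstar {n : ℕ} {x : Fin n → ℝ} (hx : ∀ i, 0 ≤ x i) :
    (x, 0, 0) ∈ Wstar n := by
  refine ⟨x, 0, hx, fun _ => le_rfl, ?_⟩
  ext <;> simp [Prod.fst_sum, Prod.snd_sum, Pi.single_apply]

theorem convexHull_add_Wstar_subset {n : ℕ} {S T : Set ((Fin n → ℝ) × (Fin n → ℝ) × ℝ)}
    (h : T ⊆ convexHull ℝ S + Wstar n) :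
    convexHull ℝ T + Wstar n ⊆ convexHull ℝ S + Wstar n := by
  have hT : convexHull ℝ T ⊆ convexHull ℝ S + Wstar n :=
    convexHull_min h ((convex_convexHull ℝ S).add (convex_Wstar n))
  rintro _ ⟨t, ht, w, hw, rfl⟩
  obtain ⟨s, hs, w', hw', rfl⟩ := hT ht
  exact ⟨s, hs, w' + w, Wstar_add_mem hw' hw, (add_assoc s w' w).symm⟩

/-- **Dickson's lemma**, for sets whose second coordinates range over a finite set. -/
theorem exists_finset_dominating {n : ℕ} {β : Type*} (S : Set ((Fin n → ℕ) × β))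
    (hS : (Prod.snd '' S).Finite) :
    ∃ F : Finset ((Fin n → ℕ) × β), (∀ γ ∈ F, γ ∈ S) ∧
      ∀ γ ∈ S, ∃ δ ∈ F, δ.1 ≤ γ.1 ∧ δ.2 = γ.2 := by
  have hmin : ∀ b : β, {α | Minimal (fun α => (α, b) ∈ S) α}.Finite := fun b =>
    WellQuasiOrderedLE.finite_of_isAntichain (setOfPred_minimal_antichain _)
  have hfin : (⋃ b ∈ Prod.snd '' S,
      (fun α => (α, b)) '' {α | Minimal (fun α => (α, b) ∈ S) α}).Finite :=
    hS.biUnion fun b _ => (hmin b).image _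
  refine ⟨hfin.toFinset, fun γ hγ => ?_, fun γ hγ => ?_⟩
  · simp only [Set.Finite.mem_toFinset, Set.mem_iUnion] at hγ
    obtain ⟨b, -, α, hα, rfl⟩ := hγ
    exact Minimal.prop (P := fun α => (α, b) ∈ S) hα
  · obtain ⟨α, hle, hα⟩ :=
      exists_minimal_le_of_wellFoundedLT (fun α => (α, γ.2) ∈ S) γ.1 hγ
    refine ⟨(α, γ.2), ?_, hle, rfl⟩
    simp only [Set.Finite.mem_toFinset, Set.mem_iUnion]
    exact ⟨γ.2, ⟨γ, hγ, rfl⟩, α, hα, rfl⟩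

/-- Lemma 3.1: the Newton polyhedron modulo `P` is generically constant,
equal to the Newton polyhedron modulo `Q`, on `V(Q) \ V(H)`. -/
theorem newton_polyhedron_generically_constant
    {C : Type*} [CommRing C] [IsDomain C]
    (n : ℕ) (hn : 1 ≤ n)
    (Q : Ideal C) (hQ : Q.IsPrime)
    (c : (Fin n → ℕ) × (Fin n → ℕ) × ℕ → C)
    (hfin : {bk : (Fin n → ℕ) × ℕ | ∃ α : Fin n → ℕ, c (α, bk.1, bk.2) ≠ 0}.Finite) :
    ∃ H : C, H ∉ Q ∧
      ∀ P : Ideal C, P.IsPrime → Q ≤ P → H ∉ P →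
        convexHull ℝ (toR n '' suppMod c P) + Wstar n =
        convexHull ℝ (toR n '' suppMod c Q) + Wstar n := by
  obtain ⟨F, hFS, hF⟩ := exists_finset_dominating (suppMod c Q) (hfin.subset (by
    rintro _ ⟨γ, hγ, rfl⟩
    exact ⟨γ.1, fun h0 => hγ (by rw [show c γ = 0 from h0]; exact Q.zero_mem)⟩))
  refine ⟨∏ γ ∈ F, c γ, fun h => ?_, fun P _ hQP hH => ?_⟩
  · obtain ⟨γ, hγ, hcγ⟩ := hQ.prod_mem_iff.mp h
    exact hFS γ hγ hcγ
  refine Set.Subset.antisymm (Set.add_subset_add_right (convexHull_mono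
    (Set.image_mono fun γ hγ h => hγ (hQP h)))) (convexHull_add_Wstar_subset ?_)
  rintro _ ⟨γ, hγ, rfl⟩
  obtain ⟨δ, hδF, hle, heq⟩ := hF γ hγ
  have hδP : δ ∈ suppMod c P := fun h => hH (P.prod_mem hδF h)
  refine ⟨toR n δ, subset_convexHull ℝ _ ⟨δ, hδP, rfl⟩, (fun i => (γ.1 i : ℝ) - δ.1 i, 0, 0),
    mk_zero_mem_Wstar fun i => sub_nonneg.mpr (Nat.cast_le.mpr (hle i)), ?_⟩
  ext <;> simp [toR, heq]
end

section
/- Let k ≥ 1 and let S ⊆ ℕ^k be any set. Then there exists a finite subset E ⊆ S such that convexHull(S) + ℝ_{≥0}^k = convexHull(E) + ℝ_{≥0}^k as subsets of ℝ^k, where ℝ_{≥0}^k denotes the nonnegative orthant. -/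
open Pointwise

/-- A subset of a well-quasi-ordered partial order has a finite subset such that
each of its elements lies above a member of that finite subset. -/
theorem Set.exists_finite_subset_forall_exists_le {α : Type*} [PartialOrder α]
    [WellQuasiOrderedLE α] (S : Set α) :
    ∃ E ⊆ S, E.Finite ∧ ∀ x ∈ S, ∃ e ∈ E, e ≤ x := by
  refine ⟨{x | Minimal (· ∈ S) x}, fun x hx ↦ hx.prop, ?_, fun x hx ↦ ?_⟩
  · exact WellQuasiOrderedLE.finite_of_isAntichain (setOfPred_minimal_antichain _)
  · obtain ⟨e, hex, he⟩ := exists_minimal_le_of_wellFoundedLT (· ∈ S) x hx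
    exact ⟨e, he, hex⟩

/-- If `A ⊆ B` and every point of `B` lies in `A + C` for a convex set `C` closed under addition,
then the convex hulls of `A` and `B` agree after adding `C`. -/
theorem convexHull_add_eq_of_subset_add {V : Type*} [AddCommGroup V] [Module ℝ V]
    {A B C : Set V} (hC : Convex ℝ C) (hCC : C + C ⊆ C) (hAB : A ⊆ B) (hBA : B ⊆ A + C) :
    convexHull ℝ B + C = convexHull ℝ A + C := by
  refine Set.Subset.antisymm ?_ (Set.add_subset_add_right (convexHull_mono hAB))
  calc convexHull ℝ B + C ⊆ (convexHull ℝ A + C) + C :=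
        Set.add_subset_add_right <| convexHull_min
          (hBA.trans (Set.add_subset_add_right (subset_convexHull ℝ A)))
          ((convex_convexHull ℝ A).add hC)
    _ = convexHull ℝ A + (C + C) := add_assoc _ _ _
    _ ⊆ convexHull ℝ A + C := Set.add_subset_add_left hCC

/-- Dickson-type finite generation of Newton polyhedra with respect to the nonnegative
orthant: for any `S ⊆ ℕ^k`, there is a finite `E ⊆ S` with
`convexHull S + ℝ_{≥0}^k = convexHull E + ℝ_{≥0}^k`. -/
theorem newton_polyhedron_orthant_finitely_generated
    (k : ℕ) (hk : 1 ≤ k) (S : Set (Fin k → ℕ)) :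
    ∃ E : Set (Fin k → ℕ), E ⊆ S ∧ E.Finite ∧
      convexHull ℝ ((fun γ : Fin k → ℕ => fun i => (γ i : ℝ)) '' S) +
          {x : Fin k → ℝ | ∀ i, 0 ≤ x i} =
        convexHull ℝ ((fun γ : Fin k → ℕ => fun i => (γ i : ℝ)) '' E) +
          {x : Fin k → ℝ | ∀ i, 0 ≤ x i} := by
  obtain ⟨E, hES, hE, hle⟩ := S.exists_finite_subset_forall_exists_le
  refine ⟨E, hES, hE, convexHull_add_eq_of_subset_add (convex_Ici (0 : Fin k → ℝ)) ?_
    (Set.image_mono hES) ?_⟩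
  · rintro _ ⟨x, hx, y, hy, rfl⟩ i
    exact add_nonneg (hx i) (hy i)
  · rintro _ ⟨γ, hγ, rfl⟩
    obtain ⟨e, he, heγ⟩ := hle γ hγ
    refine ⟨_, ⟨e, he, rfl⟩, fun i ↦ (γ i : ℝ) - e i, fun i ↦ ?_, ?_⟩
    · exact sub_nonneg.2 (Nat.cast_le.2 (heγ i))
    · ext i
      simp
end

section
/- Let n ≥ 1 and let W = {(u,v) ∈ ℝ^n × ℝ^n : for all i, u_i ≤ 0 and u_i + v_i ≥ 0}. Let L = {(a, 0) ∈ ℤ^{2n} × ℤ : for all w ∈ W, ⟨w, a⟩ ≤ 0} ⊆ ℤ^{2n+1}. Then for every nonempty subset S ⊆ ℕ^{2n+1}, one has convexHull(S + L) = convexHull(S) + W^⋆ as subsets of ℝ^{2n+1}, where S + L = {s + l : s ∈ S, l ∈ L} ⊆ ℤ^{2n+1}. -/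
open Pointwise

/-- Embedding of `ℕ^n × ℕ^n × ℕ` into `ℤ^n × ℤ^n × ℤ`. -/
def tripToZ (n : ℕ) (γ : (Fin n → ℕ) × (Fin n → ℕ) × ℕ) :
    (Fin n → ℤ) × (Fin n → ℤ) × ℤ :=
  (fun i => (γ.1 i : ℤ), fun i => (γ.2.1 i : ℤ), (γ.2.2 : ℤ))

/-- Embedding of `ℤ^n × ℤ^n × ℤ` into `ℝ^n × ℝ^n × ℝ`. -/
def toRZ (n : ℕ) (γ : (Fin n → ℤ) × (Fin n → ℤ) × ℤ) :
    (Fin n → ℝ) × (Fin n → ℝ) × ℝ :=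
  (fun i => (γ.1 i : ℝ), fun i => (γ.2.1 i : ℝ), (γ.2.2 : ℝ))

/-- The set of admissible weight vectors `W ⊆ ℝ^n × ℝ^n`:
`(u,v)` with `u_i ≤ 0` and `u_i + v_i ≥ 0` for all `i`. -/
def admissibleW (n : ℕ) : Set ((Fin n → ℝ) × (Fin n → ℝ)) :=
  { w | ∀ i, w.1 i ≤ 0 ∧ 0 ≤ w.1 i + w.2 i }

/-- The lattice points `(a,0) ∈ ℤ^{2n} × ℤ` with `⟨w,a⟩ ≤ 0` for all admissible
weight vectors `w`. -/
def dualLattice (n : ℕ) : Set ((Fin n → ℤ) × (Fin n → ℤ) × ℤ) :=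
  { l | l.2.2 = 0 ∧ ∀ w ∈ admissibleW n,
      (∑ i : Fin n, w.1 i * (l.1 i : ℝ)) + ∑ i : Fin n, w.2 i * (l.2.1 i : ℝ) ≤ 0 }

theorem mem_Wstar_iff {n : ℕ} {p : (Fin n → ℝ) × (Fin n → ℝ) × ℝ} :
    p ∈ Wstar n ↔ p.2.2 = 0 ∧ ∀ i, p.2.1 i ≤ p.1 i ∧ p.2.1 i ≤ 0 := by
  have key : ∀ a b : Fin n → ℝ, ∑ i : Fin n,
      (a i • ((Pi.single i 1 : Fin n → ℝ), (0 : Fin n → ℝ), (0 : ℝ)) +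
        b i • (-(Pi.single i 1 : Fin n → ℝ), -(Pi.single i 1 : Fin n → ℝ), (0 : ℝ))) =
      (a - b, -b, 0) := by
    intro a b
    refine Prod.ext ?_ (Prod.ext ?_ ?_)
    · ext j
      simp [Prod.fst_sum, Finset.sum_add_distrib, Pi.single_apply, sub_eq_add_neg]
    · ext j
      simp [Prod.fst_sum, Prod.snd_sum, Pi.single_apply]
    · simp [Prod.snd_sum]
  constructor
  · rintro ⟨a, b, ha, hb, rfl⟩
    rw [key]
    exact ⟨rfl, fun i => ⟨by simpa using ha i, by simpa using hb i⟩⟩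
  · rintro ⟨h0, h⟩
    refine ⟨p.1 - p.2.1, -p.2.1, fun i => by simpa using (h i).1,
      fun i => by simpa using (h i).2, ?_⟩
    rw [key]
    refine Prod.ext ?_ (Prod.ext ?_ h0) <;> simp

theorem mem_dualLattice_iff {n : ℕ} {l : (Fin n → ℤ) × (Fin n → ℤ) × ℤ} :
    l ∈ dualLattice n ↔ l.2.2 = 0 ∧ ∀ i, l.2.1 i ≤ l.1 i ∧ l.2.1 i ≤ 0 := by
  refine and_congr_right fun _ => ⟨fun h i => ⟨?_, ?_⟩, fun h w hw => ?_⟩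
  · have := h (-Pi.single i 1, Pi.single i 1) fun j => by
      by_cases hj : j = i <;> simp [hj]
    simp [Pi.single_apply] at this
    exact_mod_cast this
  · have := h (0, Pi.single i 1) fun j => by
      by_cases hj : j = i <;> simp [hj]
    simp [Pi.single_apply] at this
    exact_mod_cast this
  · rw [← Finset.sum_add_distrib]
    refine Finset.sum_nonpos fun i _ => ?_
    have h1 : (l.2.1 i : ℝ) ≤ l.1 i := mod_cast (h i).1
    have h2 : (l.2.1 i : ℝ) ≤ 0 := mod_cast (h i).2
    nlinarith [mul_nonneg (neg_nonneg.2 (hw i).1) (sub_nonneg.2 h1),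
      mul_nonneg (hw i).2 (neg_nonneg.2 h2)]

theorem toRZ_add {n : ℕ} (x y : (Fin n → ℤ) × (Fin n → ℤ) × ℤ) :
    toRZ n (x + y) = toRZ n x + toRZ n y := by
  refine Prod.ext ?_ (Prod.ext ?_ ?_)
  · ext; simp [toRZ]
  · ext; simp [toRZ]
  · simp [toRZ]

theorem image_toRZ_add {n : ℕ} (s t : Set ((Fin n → ℤ) × (Fin n → ℤ) × ℤ)) :
    toRZ n '' (s + t) = toRZ n '' s + toRZ n '' t :=
  Set.image_image2_distrib toRZ_add

theorem toRZ_tripToZ {n : ℕ} (γ : (Fin n → ℕ) × (Fin n → ℕ) × ℕ) :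
    toRZ n (tripToZ n γ) = toR n γ := by
  simp [toRZ, tripToZ, toR]

/-- A convex additive submonoid of a real vector space is closed under nonnegative scaling. -/
theorem AddSubmonoid.smul_mem_of_convex {E : Type*} [AddCommGroup E] [Module ℝ E]
    {M : AddSubmonoid E} (hM : Convex ℝ (M : Set E)) {c : ℝ} (hc : 0 ≤ c) {x : E}
    (hx : x ∈ M) : c • x ∈ M := by
  obtain ⟨m, hm⟩ := exists_nat_gt c
  have hm0 : (0 : ℝ) < m := hc.trans_lt hm
  have := hM.smul_mem_of_zero_mem M.zero_mem (M.nsmul_mem hx m)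
    ⟨div_nonneg hc hm0.le, (div_le_one hm0).2 hm.le⟩
  rwa [← Nat.cast_smul_eq_nsmul ℝ, smul_smul, div_mul_cancel₀ _ hm0.ne'] at this

theorem dualLattice_add_subset (n : ℕ) : dualLattice n + dualLattice n ⊆ dualLattice n := by
  rintro _ ⟨x, hx, y, hy, rfl⟩
  rw [mem_dualLattice_iff] at hx hy ⊢
  exact ⟨by simp [hx.1, hy.1], fun i => ⟨add_le_add (hx.2 i).1 (hy.2 i).1,
    add_nonpos (hx.2 i).2 (hy.2 i).2⟩⟩

theorem convexHull_dualLattice (n : ℕ) :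
    convexHull ℝ (toRZ n '' dualLattice n) = Wstar n := by
  refine (convexHull_min ?_ (convex_Wstar n)).antisymm ?_
  · rintro _ ⟨l, hl, rfl⟩
    rw [mem_dualLattice_iff] at hl
    exact mem_Wstar_iff.2 ⟨by simp [toRZ, hl.1], fun i =>
      ⟨Int.cast_le.2 (hl.2 i).1, Int.cast_nonpos.2 (hl.2 i).2⟩⟩
  · let M : AddSubmonoid ((Fin n → ℝ) × (Fin n → ℝ) × ℝ) :=
      { carrier := convexHull ℝ (toRZ n '' dualLattice n)
        zero_mem' := subset_convexHull ℝ _ ⟨0, mem_dualLattice_iff.2 (by simp), by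
          refine Prod.ext ?_ (Prod.ext ?_ ?_) <;> simp [toRZ] <;> rfl⟩
        add_mem' := fun {x y} hx hy => by
          have h := Set.add_mem_add hx hy
          rw [← convexHull_add, ← image_toRZ_add] at h
          exact convexHull_mono (Set.image_mono (dualLattice_add_subset n)) h }
    have hM : Convex ℝ (M : Set ((Fin n → ℝ) × (Fin n → ℝ) × ℝ)) := convex_convexHull ℝ _
    rintro _ ⟨a, b, ha, hb, rfl⟩
    refine M.sum_mem fun i _ => M.add_mem (M.smul_mem_of_convex hM (ha i) ?_)
      (M.smul_mem_of_convex hM (hb i) ?_)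
    · refine subset_convexHull ℝ _ ⟨(Pi.single i 1, 0, 0), mem_dualLattice_iff.2
        ⟨rfl, fun j => ?_⟩, ?_⟩
      · by_cases hj : j = i <;> simp [hj]
      · refine Prod.ext (funext fun j => ?_) (Prod.ext (funext fun j => ?_) ?_) <;>
          simp [toRZ, Pi.single_apply]
    · refine subset_convexHull ℝ _ ⟨(-Pi.single i 1, -Pi.single i 1, 0), mem_dualLattice_iff.2
        ⟨rfl, fun j => ?_⟩, ?_⟩
      · by_cases hj : j = i <;> simp [hj]
      · refine Prod.ext (funext fun j => ?_) (Prod.ext (funext fun j => ?_) ?_) <;>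
          simp [toRZ, Pi.single_apply]

/-- The Newton polyhedron `convexHull (S + L)` of the paper coincides with
`convexHull S + W^⋆`. -/
theorem convexHull_add_dualLattice (n : ℕ) (hn : 1 ≤ n)
    (S : Set ((Fin n → ℕ) × (Fin n → ℕ) × ℕ)) (hS : S.Nonempty) :
    convexHull ℝ (toRZ n '' (tripToZ n '' S + dualLattice n)) =
      convexHull ℝ (toR n '' S) + Wstar n := by
  rw [image_toRZ_add, convexHull_add, convexHull_dualLattice, Set.image_image]
  simp only [toRZ_tripToZ]
end

section
/- Let n ≥ 1, let C be a commutative integral domain and let Q be a proper prime ideal of C. Let c : ℕ^n × ℕ^n × ℕ → C be a family of elements of C, and let E ⊆ Supp_Q(c) be a finite subset such that convexHull(Supp_Q(c)) + W^⋆ = convexHull(E) + W^⋆. Set H = Π_{γ ∈ E} c(γ) (with H = 1 if E is empty). Then H ∈ C \ Q, and for every prime ideal P of C with Q ⊆ P and H ∉ P one has Supp_P(c) ⊆ Supp_Q(c), E ⊆ Supp_P(c), and convexHull(Supp_P(c)) + W^⋆ = convexHull(Supp_Q(c)) + W^⋆. -/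
open Pointwise

/-- The explicit construction of the element `H` in the proof of Lemma 3.1: given a
finite subset `E` of the support modulo `Q` whose Newton polyhedron is that of the full
support modulo `Q`, the product `H` of the coefficients over `E` lies outside `Q`, and
for every prime `P ⊇ Q` avoiding `H` the support modulo `P` is squeezed between `E` and
the support modulo `Q`, and the Newton polyhedra modulo `P` and `Q` agree. -/
theorem newton_polyhedron_constancy_witness
    {C : Type*} [CommRing C] [IsDomain C]
    (n : ℕ) (hn : 1 ≤ n)
    (Q : Ideal C) (hQ : Q.IsPrime)
    (c : (Fin n → ℕ) × (Fin n → ℕ) × ℕ → C)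
    (E : Finset ((Fin n → ℕ) × (Fin n → ℕ) × ℕ))
    (hE : (E : Set ((Fin n → ℕ) × (Fin n → ℕ) × ℕ)) ⊆ suppMod c Q)
    (hNew : convexHull ℝ (toR n '' suppMod c Q) + Wstar n =
      convexHull ℝ (toR n '' (E : Set ((Fin n → ℕ) × (Fin n → ℕ) × ℕ))) + Wstar n) :
    (∏ γ ∈ E, c γ) ∉ Q ∧
      ∀ P : Ideal C, P.IsPrime → Q ≤ P → (∏ γ ∈ E, c γ) ∉ P →
        suppMod c P ⊆ suppMod c Q ∧
        (E : Set ((Fin n → ℕ) × (Fin n → ℕ) × ℕ)) ⊆ suppMod c P ∧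
        convexHull ℝ (toR n '' suppMod c P) + Wstar n =
          convexHull ℝ (toR n '' suppMod c Q) + Wstar n := by
  refine ⟨fun h => ?_, fun P hP hQP hH => ?_⟩
  · obtain ⟨γ, hγ, hγQ⟩ := hQ.prod_mem_iff.mp h
    exact hE hγ hγQ
  · have hPQ : suppMod c P ⊆ suppMod c Q := fun _ hγ hγQ => hγ (hQP hγQ)
    have hEP : (E : Set ((Fin n → ℕ) × (Fin n → ℕ) × ℕ)) ⊆ suppMod c P :=
      fun γ hγ hγP => hH (hP.prod_mem_iff.mpr ⟨γ, hγ, hγP⟩)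
    refine ⟨hPQ, hEP, Set.Subset.antisymm ?_ ?_⟩
    · exact Set.add_subset_add_right (convexHull_mono (Set.image_mono hPQ))
    · rw [hNew]
      exact Set.add_subset_add_right (convexHull_mono (Set.image_mono hEP))
end
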